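/- ε^L(h g_L^{-2}) = ε^R(g_R^{-2} h), and this element ı of A is invertible, positive, satisfies S(ı) = ı, and is hypercentral, i.e. ı ∈ A^L ∩ A^R ∩ Z(A). -/

import Mathlib

open scoped TensorProduct

noncomputable section

/-- An element of a `C*`-algebra is positive iff it is of the form `star y * y`. -/
def IsPosElem {A : Type*} [Mul A] [Star A] (x : A) : Prop := ∃ y : A, x = star y * y

section Helpers

variable {A : Type*} [NormedRing A] [StarRing A] [CStarRing A]
  [NormedAlgebra ℂ A] [StarModule ℂ A]

/-- Apply a linear functional to the first leg of a tensor (`⟨φ, u₁⟩ u₂`). -/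
def lapp (φ : A →ₗ[ℂ] ℂ) : A ⊗[ℂ] A →ₗ[ℂ] A :=
  (TensorProduct.lid ℂ A).toLinearMap ∘ₗ TensorProduct.map φ LinearMap.id

/-- Apply a linear functional to the second leg of a tensor (`⟨φ, u₂⟩ u₁`). -/
def rapp (φ : A →ₗ[ℂ] ℂ) : A ⊗[ℂ] A →ₗ[ℂ] A :=
  (TensorProduct.rid ℂ A).toLinearMap ∘ₗ TensorProduct.map LinearMap.id φ

/-- Apply a pair of linear functionals to the two legs of a tensor (`⟨φ, u₁⟩⟨ψ, u₂⟩`). -/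
def papp (φ ψ : A →ₗ[ℂ] ℂ) : A ⊗[ℂ] A →ₗ[ℂ] ℂ :=
  (TensorProduct.lid ℂ ℂ).toLinearMap ∘ₗ TensorProduct.map φ ψ

end Helpers

/-- A `C*`-weak Hopf algebra: a finite-dimensional unital `C*`-algebra `A` equipped with a
comultiplication `Δ` (written in Sweedler notation `Δ x = x₍₁₎ ⊗ x₍₂₎`), counit `ε` and
antipode `S`, satisfying the axioms of Böhm–Szlachányi.  The field `starT` is the
(componentwise) star operation on `A ⊗[ℂ] A`, characterized by additivity and its values on
pure tensors. -/
structure WeakHopfData (A : Type*) [NormedRing A] [StarRing A] [CStarRing A]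
    [NormedAlgebra ℂ A] [StarModule ℂ A] [FiniteDimensional ℂ A] : Type _ where
  Δ : A →ₗ[ℂ] A ⊗[ℂ] A
  ε : A →ₗ[ℂ] ℂ
  S : A ≃ₗ[ℂ] A
  starT : A ⊗[ℂ] A → A ⊗[ℂ] A
  starT_add : ∀ u v : A ⊗[ℂ] A, starT (u + v) = starT u + starT v
  starT_tmul : ∀ a b : A, starT (a ⊗ₜ[ℂ] b) = star a ⊗ₜ[ℂ] star b
  /-- coassociativity of the comultiplication -/
  coassoc : (TensorProduct.assoc ℂ A A A).toLinearMap ∘ₗ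
      (TensorProduct.map Δ LinearMap.id) ∘ₗ Δ = (TensorProduct.map LinearMap.id Δ) ∘ₗ Δ
  /-- counit axiom, left version -/
  counit_left : (TensorProduct.lid ℂ A).toLinearMap ∘ₗ (TensorProduct.map ε LinearMap.id) ∘ₗ Δ
      = LinearMap.id
  /-- counit axiom, right version -/
  counit_right : (TensorProduct.rid ℂ A).toLinearMap ∘ₗ (TensorProduct.map LinearMap.id ε) ∘ₗ Δ
      = LinearMap.id
  /-- the comultiplication is multiplicative -/
  Δ_mul : ∀ x y : A, Δ (x * y) = Δ x * Δ y
  /-- the star operation is comultiplicative -/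
  Δ_star : ∀ x : A, Δ (star x) = starT (Δ x)
  /-- the unit is weakly comultiplicative:
  `(Δ ⊗ id)(Δ 1) = (Δ 1 ⊗ 1)(1 ⊗ Δ 1)` -/
  Δ_one_weak : (TensorProduct.map Δ LinearMap.id) (Δ 1)
      = (Δ 1 ⊗ₜ[ℂ] (1 : A)) * ((TensorProduct.assoc ℂ A A A).symm ((1 : A) ⊗ₜ[ℂ] Δ 1))
  /-- the unit is weakly comultiplicative:
  `(Δ ⊗ id)(Δ 1) = (1 ⊗ Δ 1)(Δ 1 ⊗ 1)` -/
  Δ_one_weak' : (TensorProduct.map Δ LinearMap.id) (Δ 1)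
      = ((TensorProduct.assoc ℂ A A A).symm ((1 : A) ⊗ₜ[ℂ] Δ 1)) * (Δ 1 ⊗ₜ[ℂ] (1 : A))
  /-- the counit is weakly multiplicative: `ε (x y z) = ε (x y₍₁₎) ε (y₍₂₎ z)` -/
  ε_weak : ∀ x y z : A,
      ε (x * y * z) = papp (ε ∘ₗ LinearMap.mulLeft ℂ x) (ε ∘ₗ LinearMap.mulRight ℂ z) (Δ y)
  /-- the counit is weakly multiplicative: `ε (x y z) = ε (x y₍₂₎) ε (y₍₁₎ z)` -/
  ε_weak' : ∀ x y z : A,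
      ε (x * y * z) = papp (ε ∘ₗ LinearMap.mulRight ℂ z) (ε ∘ₗ LinearMap.mulLeft ℂ x) (Δ y)
  /-- antipode axiom: `x₍₁₎ S(x₍₂₎) = ε (1₍₁₎ x) 1₍₂₎` -/
  antipode_left : ∀ x : A,
      LinearMap.mul' ℂ A ((TensorProduct.map LinearMap.id S.toLinearMap) (Δ x))
        = lapp (ε ∘ₗ LinearMap.mulRight ℂ x) (Δ 1)
  /-- antipode axiom: `S(x₍₁₎) x₍₂₎ = 1₍₁₎ ε (x 1₍₂₎)` -/
  antipode_right : ∀ x : A,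
      LinearMap.mul' ℂ A ((TensorProduct.map S.toLinearMap LinearMap.id) (Δ x))
        = rapp (ε ∘ₗ LinearMap.mulLeft ℂ x) (Δ 1)
  /-- the antipode is antimultiplicative -/
  S_antimul : ∀ x y : A, S (x * y) = S y * S x
  /-- the antipode is anticomultiplicative -/
  S_anticomul : ∀ x : A,
      Δ (S x) = (TensorProduct.comm ℂ A A) ((TensorProduct.map S.toLinearMap S.toLinearMap) (Δ x))

namespace WeakHopfData

variable {A : Type*} [NormedRing A] [StarRing A] [CStarRing A]
  [NormedAlgebra ℂ A] [StarModule ℂ A] [FiniteDimensional ℂ A]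

/-- The source counital map `ε^L (x) = x₍₁₎ S(x₍₂₎)`. -/
def εL (W : WeakHopfData A) : A →ₗ[ℂ] A :=
  LinearMap.mul' ℂ A ∘ₗ TensorProduct.map LinearMap.id W.S.toLinearMap ∘ₗ W.Δ

/-- The target counital map `ε^R (x) = S(x₍₁₎) x₍₂₎`. -/
def εR (W : WeakHopfData A) : A →ₗ[ℂ] A :=
  LinearMap.mul' ℂ A ∘ₗ TensorProduct.map W.S.toLinearMap LinearMap.id ∘ₗ W.Δ

/-- Full contraction of the iterated coproduct `Δ⁽ⁿ⁾ x = x₍₁₎ ⊗ ⋯ ⊗ x₍ₙ₊₁₎` against a family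
of `n+1` linear functionals: `sweedlerEval W n φ x = ⟨φ 0, x₍₁₎⟩ ⋯ ⟨φ n, x₍ₙ₊₁₎⟩`.
Since linear functionals separate the points of a tensor power, identities between iterated
coproducts are faithfully expressed through these contractions. -/
def sweedlerEval (W : WeakHopfData A) : (n : ℕ) → (Fin (n + 1) → (A →ₗ[ℂ] ℂ)) → (A →ₗ[ℂ] ℂ)
  | 0, φ => φ 0
  | n + 1, φ => papp (sweedlerEval W n (Fin.init φ)) (φ (Fin.last (n + 1))) ∘ₗ W.Δ

end WeakHopfData

/-- A `C*`-weak Hopf algebra together with its canonical distinguished elements: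
the Haar integral `h`, the dual Haar integral `hHat`, the square roots `gL`, `gR` of
`E^L h`, `E^R h` (whence the canonical grouplike element `g = gL * gR⁻¹`), real powers
`gLpow`, `gRpow` of `gL` and `gR`, and a positive square root operation `sqrt`;
all characterized by the (uniquely determining) properties listed as fields. -/
structure HaarPkg (A : Type*) [NormedRing A] [StarRing A] [CStarRing A]
    [NormedAlgebra ℂ A] [StarModule ℂ A] [FiniteDimensional ℂ A] : Type _ where
  W : WeakHopfData A
  /-- the Haar integral -/
  h : A
  haar_left : ∀ x : A, x * h = WeakHopfData.εL W x * h
  haar_right : ∀ x : A, h * x = h * WeakHopfData.εR W x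
  haar_counitL : WeakHopfData.εL W h = 1
  haar_counitR : WeakHopfData.εR W h = 1
  haar_idem : h * h = h
  haar_star : star h = h
  haar_S : W.S h = h
  haar_nondeg : ∀ y : A, ∃ φ ψ : A →ₗ[ℂ] ℂ, lapp φ (W.Δ h) = y ∧ rapp ψ (W.Δ h) = y
  /-- the Haar integral of the dual weak Hopf algebra `A*`, as a linear functional on `A` -/
  hHat : A →ₗ[ℂ] ℂ
  hHat_pos : ∀ x : A, ∃ r : ℝ, 0 ≤ r ∧ hHat (star x * x) = (r : ℂ)
  hHat_S : ∀ x : A, hHat (W.S x) = hHat x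
  /-- `gL = (E^L h)^{1/2}` -/
  gL : A
  /-- `gR = (E^R h)^{1/2}` -/
  gR : A
  gL_pos : IsPosElem gL
  gR_pos : IsPosElem gR
  gL_unit : IsUnit gL
  gR_unit : IsUnit gR
  gL_sq : gL * gL = rapp hHat (W.Δ h)
  gR_sq : gR * gR = lapp hHat (W.Δ h)
  gL_mem : gL ∈ Set.range (WeakHopfData.εL W)
  gR_mem : gR ∈ Set.range (WeakHopfData.εR W)
  gR_S : gR = W.S gL
  gLR_comm : gL * gR = gR * gL
  /-- the canonical grouplike element `g = gL * gR⁻¹` is positive -/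
  g_pos : IsPosElem (gL * Ring.inverse gR)
  g_unit : IsUnit (gL * Ring.inverse gR)
  /-- `Δ g = (g ⊗ g) Δ 1` -/
  g_grouplike : W.Δ (gL * Ring.inverse gR)
      = ((gL * Ring.inverse gR) ⊗ₜ[ℂ] (gL * Ring.inverse gR)) * W.Δ 1
  /-- `Δ g = Δ 1 (g ⊗ g)` -/
  g_grouplike' : W.Δ (gL * Ring.inverse gR)
      = W.Δ 1 * ((gL * Ring.inverse gR) ⊗ₜ[ℂ] (gL * Ring.inverse gR))
  /-- `S g = g⁻¹` -/
  g_S : W.S (gL * Ring.inverse gR) = Ring.inverse (gL * Ring.inverse gR)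
  /-- `S² x = g x g⁻¹` -/
  S_sq : ∀ x : A,
      W.S (W.S x) = (gL * Ring.inverse gR) * x * Ring.inverse (gL * Ring.inverse gR)
  /-- `h₍₁₎ ⊗ g h₍₂₎ g = h₍₂₎ ⊗ h₍₁₎` -/
  haar_flip : TensorProduct.map LinearMap.id
      (LinearMap.mulLeft ℂ (gL * Ring.inverse gR) ∘ₗ LinearMap.mulRight ℂ (gL * Ring.inverse gR))
      (W.Δ h) = (TensorProduct.comm ℂ A A) (W.Δ h)
  /-- dual integral relation `⟨ĥ, x (h gL⁻²)⟩ = ε x` -/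
  hHat_dual₁ : ∀ x : A, hHat (x * (h * (Ring.inverse gL * Ring.inverse gL))) = W.ε x
  /-- dual integral relation `⟨ĥ, (gR⁻² h) x⟩ = ε x` -/
  hHat_dual₂ : ∀ x : A, hHat ((Ring.inverse gR * Ring.inverse gR * h) * x) = W.ε x
  /-- dual integral relation `⟨ĥ, (h gL⁻²)₍₂₎⟩ (h gL⁻²)₍₁₎ = 1` -/
  hHat_dual₃ : rapp hHat (W.Δ (h * (Ring.inverse gL * Ring.inverse gL))) = 1
  /-- dual integral relation `⟨ĥ, (gR⁻² h)₍₁₎⟩ (gR⁻² h)₍₂₎ = 1` -/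
  hHat_dual₄ : lapp hHat (W.Δ (Ring.inverse gR * Ring.inverse gR * h)) = 1
  /-- the positive square root, via the continuous functional calculus -/
  sqrt : A → A
  sqrt_pos : ∀ x : A, IsPosElem x → IsPosElem (sqrt x)
  sqrt_mul_self : ∀ x : A, IsPosElem x → sqrt x * sqrt x = x
  /-- real powers of `gL`, via the continuous functional calculus -/
  gLpow : ℝ → A
  /-- real powers of `gR`, via the continuous functional calculus -/
  gRpow : ℝ → A
  gLpow_one : gLpow 1 = gL
  gRpow_one : gRpow 1 = gR
  gLpow_zero : gLpow 0 = 1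
  gRpow_zero : gRpow 0 = 1
  gLpow_add : ∀ s t : ℝ, gLpow (s + t) = gLpow s * gLpow t
  gRpow_add : ∀ s t : ℝ, gRpow (s + t) = gRpow s * gRpow t
  gLpow_pos : ∀ t : ℝ, IsPosElem (gLpow t)
  gRpow_pos : ∀ t : ℝ, IsPosElem (gRpow t)
  gLpow_continuous : Continuous gLpow
  gRpow_continuous : Continuous gRpow

namespace HaarPkg

variable {A : Type*} [NormedRing A] [StarRing A] [CStarRing A]
  [NormedAlgebra ℂ A] [StarModule ℂ A] [FiniteDimensional ℂ A]
variable (P : HaarPkg A)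

/-- The canonical grouplike element `g = gL gR⁻¹`. -/
def g : A := P.gL * Ring.inverse P.gR

/-- The Watatani index `ı = ε^L (h gL⁻²)` of the Haar conditional expectations. -/
def iotaEl : A := WeakHopfData.εL P.W (P.h * (Ring.inverse P.gL * Ring.inverse P.gL))

/-- The element `ȷ = ⟨ĥ, (gL⁻²)₍₁₎⟩ (gL⁻²)₍₂₎`, the dual analogue of the Watatani index. -/
def jayEl : A := lapp P.hHat (P.W.Δ (Ring.inverse P.gL * Ring.inverse P.gL))

/-- The pulling-through element `Ω = ı⁻¹ gL⁻¹ h gL⁻¹`. -/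
def Ω : A := Ring.inverse P.iotaEl * Ring.inverse P.gL * P.h * Ring.inverse P.gL

/-- The map `J x = g^{-1/2} S(x) g^{1/2}`, as a linear map. -/
def Jlin : A →ₗ[ℂ] A :=
  LinearMap.mulRight ℂ (P.sqrt P.g) ∘ₗ
    LinearMap.mulLeft ℂ (Ring.inverse (P.sqrt P.g)) ∘ₗ P.W.S.toLinearMap

/-- The functional `⟨ω, x⟩ = ⟨ĥ, ȷ⁻¹ gL⁻¹ gR⁻¹ x⟩` (the dual analogue of `Ω`). -/
def ω : A →ₗ[ℂ] ℂ :=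
  P.hHat ∘ₗ LinearMap.mulLeft ℂ (Ring.inverse P.jayEl * (Ring.inverse P.gL * Ring.inverse P.gR))

/-- `ξ_L = ı^{1/2} ȷ^{1/2} gL`. -/
def ξL : A := P.sqrt P.iotaEl * P.sqrt P.jayEl * P.gL

/-- `ξ_R = ı^{1/2} ȷ^{1/2} gR`. -/
def ξR : A := P.sqrt P.iotaEl * P.sqrt P.jayEl * P.gR

/-- `ξ = ξ_L ξ_R`. -/
def ξ : A := P.ξL * P.ξR

/-- `J^L x = gL⁻¹ S(x) gL`. -/
def JL : A → A := fun x => Ring.inverse P.gL * P.W.S x * P.gL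

/-- `J^R x = gL S⁻¹(x) gL⁻¹`. -/
def JR : A → A := fun x => P.gL * P.W.S.symm x * Ring.inverse P.gL

end HaarPkg

section Slices

variable {A : Type*} [NormedRing A] [NormedAlgebra ℂ A]

@[simp]
theorem lapp_tmul (φ : A →ₗ[ℂ] ℂ) (a b : A) : lapp φ (a ⊗ₜ[ℂ] b) = φ a • b := by
  simp [lapp]

@[simp]
theorem rapp_tmul (φ : A →ₗ[ℂ] ℂ) (a b : A) : rapp φ (a ⊗ₜ[ℂ] b) = φ b • a := by
  simp [rapp]

theorem lapp_mul_one_tmul (φ : A →ₗ[ℂ] ℂ) (u : A ⊗[ℂ] A) (b : A) :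
    lapp φ (u * ((1 : A) ⊗ₜ[ℂ] b)) = lapp φ u * b := by
  induction u with
  | zero => simp
  | tmul x y => simp
  | add x y hx hy => simp [add_mul, hx, hy]

theorem rapp_tmul_one_mul (φ : A →ₗ[ℂ] ℂ) (u : A ⊗[ℂ] A) (a : A) :
    rapp φ ((a ⊗ₜ[ℂ] (1 : A)) * u) = a * rapp φ u := by
  induction u with
  | zero => simp
  | tmul x y => simp
  | add x y hx hy => simp [mul_add, hx, hy]

end Slices

namespace WeakHopfData

variable {A : Type*} [NormedRing A] [StarRing A] [CStarRing A]
  [NormedAlgebra ℂ A] [StarModule ℂ A] [FiniteDimensional ℂ A]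

/-- The convolution product of two linear endomorphisms. -/
def conv (W : WeakHopfData A) (f k : A →ₗ[ℂ] A) : A →ₗ[ℂ] A :=
  LinearMap.mul' ℂ A ∘ₗ TensorProduct.map f k ∘ₗ W.Δ

variable (W : WeakHopfData A)

theorem conv_apply (f k : A →ₗ[ℂ] A) (x : A) :
    W.conv f k x = LinearMap.mul' ℂ A (TensorProduct.map f k (W.Δ x)) := rfl

theorem conv_assoc (f k l : A →ₗ[ℂ] A) :
    W.conv (W.conv f k) l = W.conv f (W.conv k l) := by
  ext x
  have h₁ : ∀ t : A ⊗[ℂ] A, LinearMap.mul' ℂ A (TensorProduct.map (W.conv f k) l t) =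
      LinearMap.mul' ℂ A (TensorProduct.map f (LinearMap.mul' ℂ A ∘ₗ TensorProduct.map k l)
        (TensorProduct.assoc ℂ A A A (TensorProduct.map W.Δ LinearMap.id t))) := by
    intro t
    induction t with
    | zero => simp
    | add x y hx hy => simp only [map_add, hx, hy]
    | tmul a b =>
      simp only [TensorProduct.map_tmul, conv_apply, LinearMap.mul'_apply, LinearMap.id_apply]
      generalize W.Δ a = u
      induction u with
      | zero => simp
      | add x y hx hy => simp only [map_add, add_mul, TensorProduct.add_tmul, hx, hy]
      | tmul c d => simp [mul_assoc]
  have h₂ : ∀ t : A ⊗[ℂ] A, LinearMap.mul' ℂ A (TensorProduct.map f (W.conv k l) t) =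
      LinearMap.mul' ℂ A (TensorProduct.map f (LinearMap.mul' ℂ A ∘ₗ TensorProduct.map k l)
        (TensorProduct.map LinearMap.id W.Δ t)) := by
    intro t
    induction t with
    | zero => simp
    | add x y hx hy => simp only [map_add, hx, hy]
    | tmul a b => simp [conv_apply]
  rw [conv_apply, conv_apply, h₁, h₂]
  have := LinearMap.congr_fun W.coassoc x
  simp only [LinearMap.comp_apply, LinearEquiv.coe_coe] at this
  rw [this]

theorem εL_eq_conv : W.εL = W.conv LinearMap.id W.S.toLinearMap := rfl

theorem εR_eq_conv : W.εR = W.conv W.S.toLinearMap LinearMap.id := rfl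

theorem lapp_ε_Δ (x : A) : lapp W.ε (W.Δ x) = x :=
  LinearMap.congr_fun W.counit_left x

theorem rapp_ε_Δ (x : A) : rapp W.ε (W.Δ x) = x :=
  LinearMap.congr_fun W.counit_right x

theorem Δ_one_mul (x : A) : W.Δ 1 * W.Δ x = W.Δ x := by
  rw [← W.Δ_mul, one_mul]

theorem Δ_mul_one (x : A) : W.Δ x * W.Δ 1 = W.Δ x := by
  rw [← W.Δ_mul, mul_one]

theorem Δ_injective : Function.Injective W.Δ := fun x y hxy => by
  rw [← W.lapp_ε_Δ x, hxy, W.lapp_ε_Δ]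

theorem εL_apply (x : A) : W.εL x = lapp (W.ε ∘ₗ LinearMap.mulRight ℂ x) (W.Δ 1) :=
  W.antipode_left x

theorem εR_apply (x : A) : W.εR x = rapp (W.ε ∘ₗ LinearMap.mulLeft ℂ x) (W.Δ 1) :=
  W.antipode_right x

theorem conv_εL_id : W.conv W.εL LinearMap.id = LinearMap.id := by
  ext x
  have key : ∀ t : A ⊗[ℂ] A, LinearMap.mul' ℂ A (TensorProduct.map W.εL LinearMap.id t) =
      lapp W.ε (W.Δ 1 * t) := by
    intro t
    induction t with
    | zero => simp
    | add x y hx hy => simp only [map_add, mul_add, hx, hy]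
    | tmul a b =>
      simp only [TensorProduct.map_tmul, LinearMap.mul'_apply, LinearMap.id_apply, εL_apply]
      generalize W.Δ 1 = u
      induction u with
      | zero => simp
      | add x y hx hy => simp only [map_add, add_mul, hx, hy]
      | tmul c d => simp
  rw [conv_apply, key, W.Δ_one_mul, W.lapp_ε_Δ, LinearMap.id_apply]

theorem conv_id_εR : W.conv LinearMap.id W.εR = LinearMap.id := by
  ext x
  have key : ∀ t : A ⊗[ℂ] A, LinearMap.mul' ℂ A (TensorProduct.map LinearMap.id W.εR t) =
      rapp W.ε (t * W.Δ 1) := by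
    intro t
    induction t with
    | zero => simp
    | add x y hx hy => simp only [map_add, add_mul, hx, hy]
    | tmul a b =>
      simp only [TensorProduct.map_tmul, LinearMap.mul'_apply, LinearMap.id_apply, εR_apply]
      generalize W.Δ 1 = u
      induction u with
      | zero => simp
      | add x y hx hy => simp only [map_add, mul_add, hx, hy]
      | tmul c d => simp
  rw [conv_apply, key, W.Δ_mul_one, W.rapp_ε_Δ, LinearMap.id_apply]

/-- The coproduct characterization of the elements of `A^L`. -/
structure IsLeftCounital (a : A) : Prop where
  Δ_left : W.Δ a = (a ⊗ₜ[ℂ] (1 : A)) * W.Δ 1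
  Δ_right : W.Δ a = W.Δ 1 * (a ⊗ₜ[ℂ] (1 : A))

/-- The coproduct characterization of the elements of `A^R`. -/
structure IsRightCounital (b : A) : Prop where
  Δ_left : W.Δ b = ((1 : A) ⊗ₜ[ℂ] b) * W.Δ 1
  Δ_right : W.Δ b = W.Δ 1 * ((1 : A) ⊗ₜ[ℂ] b)

theorem isLeftCounital_lapp (φ : A →ₗ[ℂ] ℂ) : W.IsLeftCounital (lapp φ (W.Δ 1)) := by
  have hΔ : ∀ t : A ⊗[ℂ] A, W.Δ (lapp φ t) =
      TensorProduct.lid ℂ (A ⊗[ℂ] A) (TensorProduct.map φ LinearMap.id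
        (TensorProduct.map LinearMap.id W.Δ t)) := by
    intro t
    induction t with
    | zero => simp
    | add x y hx hy => simp only [map_add, hx, hy]
    | tmul a b => simp
  have hco := LinearMap.congr_fun W.coassoc 1
  simp only [LinearMap.comp_apply, LinearEquiv.coe_coe] at hco
  have hl : ∀ u v : A ⊗[ℂ] A, TensorProduct.lid ℂ (A ⊗[ℂ] A) (TensorProduct.map φ LinearMap.id
      (TensorProduct.assoc ℂ A A A ((u ⊗ₜ[ℂ] (1 : A)) *
        ((TensorProduct.assoc ℂ A A A).symm ((1 : A) ⊗ₜ[ℂ] v))))) =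
      (lapp φ u ⊗ₜ[ℂ] (1 : A)) * v := by
    intro u v
    induction v with
    | zero => simp
    | add x y hx hy => simp only [map_add, mul_add, TensorProduct.tmul_add, hx, hy]
    | tmul c d =>
      induction u with
      | zero => simp
      | add x y hx hy => simp only [map_add, add_mul, TensorProduct.add_tmul, hx, hy]
      | tmul a b => simp [TensorProduct.smul_tmul']
  have hr : ∀ u v : A ⊗[ℂ] A, TensorProduct.lid ℂ (A ⊗[ℂ] A) (TensorProduct.map φ LinearMap.id
      (TensorProduct.assoc ℂ A A A (((TensorProduct.assoc ℂ A A A).symm ((1 : A) ⊗ₜ[ℂ] v)) *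
        (u ⊗ₜ[ℂ] (1 : A))))) = v * (lapp φ u ⊗ₜ[ℂ] (1 : A)) := by
    intro u v
    induction v with
    | zero => simp
    | add x y hx hy => simp only [map_add, add_mul, TensorProduct.tmul_add, hx, hy]
    | tmul c d =>
      induction u with
      | zero => simp
      | add x y hx hy => simp only [map_add, mul_add, TensorProduct.add_tmul, hx, hy]
      | tmul a b => simp [TensorProduct.smul_tmul']
  constructor
  · rw [hΔ, ← hco, W.Δ_one_weak, hl]
  · rw [hΔ, ← hco, W.Δ_one_weak', hr]

theorem isRightCounital_rapp (φ : A →ₗ[ℂ] ℂ) : W.IsRightCounital (rapp φ (W.Δ 1)) := by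
  have hΔ : ∀ t : A ⊗[ℂ] A, W.Δ (rapp φ t) =
      TensorProduct.rid ℂ (A ⊗[ℂ] A) (TensorProduct.map LinearMap.id φ
        (TensorProduct.map W.Δ LinearMap.id t)) := by
    intro t
    induction t with
    | zero => simp
    | add x y hx hy => simp only [map_add, hx, hy]
    | tmul a b => simp
  have hl : ∀ u v : A ⊗[ℂ] A, TensorProduct.rid ℂ (A ⊗[ℂ] A) (TensorProduct.map LinearMap.id φ
      ((u ⊗ₜ[ℂ] (1 : A)) * ((TensorProduct.assoc ℂ A A A).symm ((1 : A) ⊗ₜ[ℂ] v)))) =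
      u * ((1 : A) ⊗ₜ[ℂ] rapp φ v) := by
    intro u v
    induction v with
    | zero => simp
    | add x y hx hy => simp only [map_add, mul_add, TensorProduct.tmul_add, hx, hy]
    | tmul c d =>
      induction u with
      | zero => simp
      | add x y hx hy => simp only [map_add, add_mul, TensorProduct.add_tmul, hx, hy]
      | tmul a b => simp
  have hr : ∀ u v : A ⊗[ℂ] A, TensorProduct.rid ℂ (A ⊗[ℂ] A) (TensorProduct.map LinearMap.id φ
      (((TensorProduct.assoc ℂ A A A).symm ((1 : A) ⊗ₜ[ℂ] v)) * (u ⊗ₜ[ℂ] (1 : A)))) =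
      ((1 : A) ⊗ₜ[ℂ] rapp φ v) * u := by
    intro u v
    induction v with
    | zero => simp
    | add x y hx hy => simp only [map_add, add_mul, TensorProduct.tmul_add, hx, hy]
    | tmul c d =>
      induction u with
      | zero => simp
      | add x y hx hy => simp only [map_add, mul_add, TensorProduct.add_tmul, hx, hy]
      | tmul a b => simp
  constructor
  · rw [hΔ, W.Δ_one_weak', hr]
  · rw [hΔ, W.Δ_one_weak, hl]

theorem isLeftCounital_εL (x : A) : W.IsLeftCounital (W.εL x) := by
  rw [W.εL_apply]
  exact W.isLeftCounital_lapp _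

theorem isRightCounital_εR (x : A) : W.IsRightCounital (W.εR x) := by
  rw [W.εR_apply]
  exact W.isRightCounital_rapp _

variable {W}

theorem IsLeftCounital.Δ_mul {a : A} (ha : W.IsLeftCounital a) (x : A) :
    W.Δ (a * x) = (a ⊗ₜ[ℂ] (1 : A)) * W.Δ x := by
  rw [W.Δ_mul, ha.Δ_left, mul_assoc, W.Δ_one_mul]

theorem IsLeftCounital.Δ_mul' {a : A} (ha : W.IsLeftCounital a) (x : A) :
    W.Δ (x * a) = W.Δ x * (a ⊗ₜ[ℂ] (1 : A)) := by
  rw [W.Δ_mul, ha.Δ_right, ← mul_assoc, W.Δ_mul_one]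

theorem IsRightCounital.Δ_mul {b : A} (hb : W.IsRightCounital b) (x : A) :
    W.Δ (b * x) = ((1 : A) ⊗ₜ[ℂ] b) * W.Δ x := by
  rw [W.Δ_mul, hb.Δ_left, mul_assoc, W.Δ_one_mul]

theorem IsLeftCounital.commute {a b : A} (ha : W.IsLeftCounital a) (hb : W.IsRightCounital b) :
    Commute a b := by
  refine W.Δ_injective ?_
  rw [ha.Δ_mul, hb.Δ_mul, hb.Δ_left, ha.Δ_left, ← mul_assoc, ← mul_assoc]
  simp

theorem IsLeftCounital.mul {a b : A} (ha : W.IsLeftCounital a) (hb : W.IsLeftCounital b) :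
    W.IsLeftCounital (a * b) := by
  constructor
  · rw [ha.Δ_mul, hb.Δ_left, ← mul_assoc]
    simp
  · rw [hb.Δ_mul', ha.Δ_right, mul_assoc]
    simp

theorem IsLeftCounital.of_mul_eq_one {a b : A} (ha : W.IsLeftCounital a) (hab : a * b = 1)
    (hba : b * a = 1) : W.IsLeftCounital b := by
  have h₁ : W.Δ 1 = (a ⊗ₜ[ℂ] (1 : A)) * W.Δ b := by rw [← ha.Δ_mul, hab]
  have h₂ : W.Δ 1 = W.Δ b * (a ⊗ₜ[ℂ] (1 : A)) := by rw [← ha.Δ_mul', hba]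
  constructor
  · rw [h₁, ← mul_assoc, Algebra.TensorProduct.tmul_mul_tmul, hba, one_mul,
      ← Algebra.TensorProduct.one_def, one_mul]
  · rw [h₂, mul_assoc, Algebra.TensorProduct.tmul_mul_tmul, hab, one_mul,
      ← Algebra.TensorProduct.one_def, mul_one]

variable (W)

theorem S_one : W.S 1 = 1 := by
  obtain ⟨y, hy⟩ := W.S.surjective 1
  have := W.S_antimul y 1
  rwa [mul_one, hy, mul_one, eq_comm] at this

theorem S_inverse {a : A} (ha : IsUnit a) : W.S (Ring.inverse a) = Ring.inverse (W.S a) := by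
  have h₁ : W.S a * W.S (Ring.inverse a) = 1 := by
    rw [← W.S_antimul, Ring.inverse_mul_cancel _ ha, W.S_one]
  have h₂ : W.S (Ring.inverse a) * W.S a = 1 := by
    rw [← W.S_antimul, Ring.mul_inverse_cancel _ ha, W.S_one]
  exact (Ring.inverse_unit ⟨W.S a, W.S (Ring.inverse a), h₁, h₂⟩).symm

theorem S_εL (x : A) : W.S (W.εL x) = W.εR (W.S x) := by
  rw [εL_eq_conv, εR_eq_conv, conv_apply, conv_apply, W.S_anticomul]
  generalize W.Δ x = t
  induction t with
  | zero => simp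
  | add x y hx hy => simp only [map_add, hx, hy]
  | tmul a b => simp [W.S_antimul]

/-- An element commuting with `A^L` and `A^R` on which the adjoint action
`x ↦ x₍₁₎ a S(x₍₂₎)` factors through `ε^L` is central. -/
theorem mem_center_of_adjoint {a : A} (hl : ∀ x, Commute a (W.εL x))
    (hr : ∀ x, Commute a (W.εR x))
    (had : ∀ x, W.conv (LinearMap.mulRight ℂ a) W.S.toLinearMap x = W.εL x * a) :
    a ∈ Set.center A := by
  have h₁ : W.conv (W.conv (LinearMap.mulRight ℂ a) W.S.toLinearMap) LinearMap.id =
      LinearMap.mulLeft ℂ a := by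
    have : W.conv (LinearMap.mulRight ℂ a) W.S.toLinearMap = LinearMap.mulLeft ℂ a ∘ₗ W.εL := by
      ext x
      simp [had, (hl x).eq]
    ext x
    rw [this, conv_apply]
    have key : ∀ t : A ⊗[ℂ] A,
        LinearMap.mul' ℂ A (TensorProduct.map (LinearMap.mulLeft ℂ a ∘ₗ W.εL) LinearMap.id t) =
        a * LinearMap.mul' ℂ A (TensorProduct.map W.εL LinearMap.id t) := by
      intro t
      induction t with
      | zero => simp
      | add x y hx hy => simp only [map_add, mul_add, hx, hy]
      | tmul c d => simp [mul_assoc]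
    rw [key, ← conv_apply, conv_εL_id]
    rfl
  have h₂ : W.conv (LinearMap.mulRight ℂ a) W.εR = LinearMap.mulRight ℂ a := by
    ext x
    rw [conv_apply]
    have key : ∀ t : A ⊗[ℂ] A,
        LinearMap.mul' ℂ A (TensorProduct.map (LinearMap.mulRight ℂ a) W.εR t) =
        LinearMap.mul' ℂ A (TensorProduct.map LinearMap.id W.εR t) * a := by
      intro t
      induction t with
      | zero => simp
      | add x y hx hy => simp only [map_add, add_mul, hx, hy]
      | tmul c d => simp [mul_assoc, (hr d).eq]
    rw [key, ← conv_apply, conv_id_εR]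
    rfl
  rw [conv_assoc, ← εR_eq_conv, h₂] at h₁
  exact Semigroup.mem_center_iff.2 fun x => LinearMap.congr_fun h₁ x

end WeakHopfData

section Positivity

open scoped ComplexOrder

variable {A : Type*}

theorem map_star_mul_conj [Ring A] [StarRing A] [Algebra ℂ A] [StarModule ℂ A] {φ : A →ₗ[ℂ] ℂ}
    (hφ : ∀ x : A, ∃ r : ℝ, 0 ≤ r ∧ φ (star x * x) = (r : ℂ)) (a b : A) :
    star (φ (star a * b)) = φ (star b * a) := by
  obtain ⟨r₁, -, h₁⟩ := hφ a
  obtain ⟨r₂, -, h₂⟩ := hφ b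
  obtain ⟨r₃, -, h₃⟩ := hφ (a + b)
  obtain ⟨r₄, -, h₄⟩ := hφ (a + Complex.I • b)
  simp only [star_add, star_smul, add_mul, mul_add, map_add, smul_mul_assoc, mul_smul_comm,
    map_smul, h₁, h₂, smul_eq_mul] at h₃ h₄
  have e₃ := congrArg Complex.im h₃
  have e₄ := congrArg Complex.im h₄
  simp at e₃ e₄
  apply Complex.ext <;> simp <;> linarith

theorem rapp_star_mul_self_nonneg [CStarAlgebra A] [PartialOrder A] [StarOrderedRing A]
    {φ : A →ₗ[ℂ] ℂ} (hφ : ∀ x : A, ∃ r : ℝ, 0 ≤ r ∧ φ (star x * x) = (r : ℂ))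
    {σ : A ⊗[ℂ] A → A ⊗[ℂ] A} (hadd : ∀ u v, σ (u + v) = σ u + σ v)
    (htmul : ∀ a b : A, σ (a ⊗ₜ[ℂ] b) = star a ⊗ₜ[ℂ] star b) (t : A ⊗[ℂ] A) :
    0 ≤ rapp φ (σ t * t) := by
  obtain ⟨s, rfl⟩ := TensorProduct.exists_finset t
  rw [← Finset.sum_coe_sort]
  let M : Matrix s s ℂ := Matrix.of fun i j => φ (star i.1.2 * j.1.2)
  have hM : M.PosSemidef := by
    refine Matrix.PosSemidef.of_dotProduct_mulVec_nonneg ?_ fun x => ?_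
    · ext i j
      exact map_star_mul_conj hφ _ _
    · obtain ⟨r, hr, he⟩ := hφ (∑ i, x i • i.1.2)
      have : star x ⬝ᵥ M.mulVec x = (r : ℂ) := by
        rw [← he]
        rw [star_sum, Finset.sum_mul_sum]
        simp only [star_smul, map_sum, smul_mul_assoc, mul_smul_comm, map_smul, smul_eq_mul, dotProduct, Matrix.mulVec, Finset.mul_sum, M,
          Matrix.of_apply, Pi.star_apply]
        refine Finset.sum_congr rfl fun i _ => Finset.sum_congr rfl fun j _ => by ring
      rw [this]
      exact_mod_cast hr
  obtain ⟨m, B, hB⟩ := Matrix.posSemidef_iff_eq_sum_vecMulVec.mp hM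
  let f : A ⊗[ℂ] A →+ A ⊗[ℂ] A := AddMonoidHom.mk' σ hadd
  have hσ : σ (∑ i : s, i.1.1 ⊗ₜ[ℂ] i.1.2) = ∑ i : s, star i.1.1 ⊗ₜ[ℂ] star i.1.2 := by
    change f _ = _
    rw [map_sum]
    exact Finset.sum_congr rfl fun i _ => htmul _ _
  have hsum : rapp φ (σ (∑ i : s, i.1.1 ⊗ₜ[ℂ] i.1.2) * ∑ i : s, i.1.1 ⊗ₜ[ℂ] i.1.2) =
      ∑ k, star (∑ i, star (B k i) • i.1.1) * ∑ i, star (B k i) • i.1.1 := by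
    have hentry : ∀ i j : s, φ (star i.1.2 * j.1.2) = ∑ k, B k i * star (B k j) := by
      intro i j
      have := congrFun (congrFun hB i) j
      simpa [M, Matrix.sum_apply, Matrix.vecMulVec_apply] using this
    simp only [hσ, Finset.sum_mul_sum, map_sum, Algebra.TensorProduct.tmul_mul_tmul, rapp_tmul,
      hentry, star_sum, star_smul, star_star, Finset.sum_smul, smul_mul_assoc, mul_smul_comm,
      smul_smul]
    calc _ = ∑ i : s, ∑ k, ∑ j : s, (B k i * star (B k j)) • (star i.1.1 * j.1.1) :=
          Finset.sum_congr rfl fun i _ => Finset.sum_comm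
      _ = _ := by
          rw [Finset.sum_comm]
          refine Finset.sum_congr rfl fun k _ => Finset.sum_congr rfl fun i _ =>
            Finset.sum_congr rfl fun j _ => ?_
          congr 1
          ring
  rw [hsum]
  exact Finset.sum_nonneg fun k _ => star_mul_self_nonneg _

theorem nonneg_and_isUnit_of_conditional [CStarAlgebra A] [PartialOrder A] [StarOrderedRing A]
    {E : A →ₗ[ℂ] A} (hE : ∀ y, 0 ≤ E (star y * y)) {a h z : A} (ha : IsSelfAdjoint a)
    (hau : IsUnit a) (hh : star h = h) (hh₂ : h * h = h) (hz : z ∈ Set.center A)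
    (hEh : E h = a * a) (hEz : E (z * h) = z * (a * a))
    (hzh : h * (Ring.inverse a * Ring.inverse a) * h = z * h) : 0 ≤ z ∧ IsUnit z := by
  obtain ⟨u, rfl⟩ := hau
  rw [Ring.inverse_unit] at hzh
  have hu : star (↑u⁻¹ : A) = ↑u⁻¹ := by
    have h₁ : star (↑u⁻¹ : A) * u = 1 := by
      rw [← star_one A, ← u.mul_inv, star_mul, ha.star_eq]
    rw [← mul_one (star _), ← u.mul_inv, ← mul_assoc, h₁, one_mul]
  set n : ℝ := ‖(u * u : A)‖ + 1 with hn
  have hn₀ : 0 < n := by positivity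
  have huu : IsSelfAdjoint (u * u : A) := by
    rw [isSelfAdjoint_iff, star_mul, ha.star_eq]
  have hle : 0 ≤ (n : ℂ) • (1 : A) - u * u := by
    have h₁ := huu.le_algebraMap_norm_self
    rw [Algebra.algebraMap_eq_smul_one] at h₁
    rw [sub_nonneg, hn]
    push_cast
    rw [add_smul, one_smul, Complex.coe_smul]
    exact h₁.trans (le_add_of_nonneg_right zero_le_one)
  obtain ⟨w, hw⟩ := CStarAlgebra.nonneg_iff_eq_star_mul_self.mp hle
  have hy : star (w * ↑u⁻¹ * h) * (w * ↑u⁻¹ * h) = (n : ℂ) • (z * h) - h := by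
    calc star (w * ↑u⁻¹ * h) * (w * ↑u⁻¹ * h)
        = h * (↑u⁻¹ * (star w * w) * ↑u⁻¹) * h := by
          simp only [star_mul, hh, hu, mul_assoc]
      _ = h * ((n : ℂ) • (↑u⁻¹ * ↑u⁻¹) - 1) * h := by
          rw [← hw]
          simp [mul_sub, sub_mul, mul_assoc]
      _ = (n : ℂ) • (z * h) - h := by
          rw [← hzh, mul_sub, sub_mul, mul_one, hh₂]
          simp
  have hpos : 0 ≤ (n : ℂ) • z - 1 := by
    have h₁ := star_left_conjugate_nonneg (hE (w * ↑u⁻¹ * h)) (↑u⁻¹ : A)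
    rw [hy, map_sub, map_smul, hEz, hEh, hu] at h₁
    have h₂ : (↑u⁻¹ : A) * ((n : ℂ) • (z * (u * u)) - u * u) * ↑u⁻¹ = (n : ℂ) • z - 1 := by
      have h₃ := Semigroup.mem_center_iff.1 hz
      rw [mul_sub, sub_mul, mul_smul_comm, smul_mul_assoc, ← mul_assoc _ z, h₃]
      simp [mul_assoc]
    rwa [h₂] at h₁
  have hone : (1 : A) ≤ (n : ℂ) • z := sub_nonneg.1 hpos
  have hn' : (n : ℂ) ≠ 0 := by exact_mod_cast hn₀.ne'
  constructor
  · have h₁ : 0 ≤ n • z := by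
      rw [← Complex.coe_smul]
      exact zero_le_one.trans hone
    have h₂ := smul_nonneg (inv_nonneg.2 hn₀.le) h₁
    rwa [inv_smul_smul₀ hn₀.ne'] at h₂
  · have h₁ : IsUnit ((n : ℂ) • z) := CStarAlgebra.isUnit_of_le 1 hone
    have h₂ : IsUnit ((Units.mk0 (n : ℂ) hn') • z) := h₁
    rwa [isUnit_smul_iff] at h₂

end Positivity

namespace WeakHopfData

variable {A : Type*} [NormedRing A] [StarRing A] [CStarRing A]
  [NormedAlgebra ℂ A] [StarModule ℂ A] [FiniteDimensional ℂ A] (W : WeakHopfData A)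

theorem conv_mulRight_εL (x y : A) :
    W.conv (LinearMap.mulRight ℂ (W.εL y)) W.S.toLinearMap x = W.εL (x * y) := by
  rw [conv_apply, εL_eq_conv, conv_apply, conv_apply, W.Δ_mul]
  generalize W.Δ x = t
  generalize W.Δ y = u
  induction t with
  | zero => simp
  | add t₁ t₂ h₁ h₂ => simp only [map_add, add_mul, h₁, h₂]
  | tmul a b =>
    induction u with
    | zero => simp
    | add u₁ u₂ h₁ h₂ =>
      simp only [map_add, mul_add, ← h₁, ← h₂]
      simp [mul_add, add_mul]
    | tmul c d => simp [W.S_antimul, mul_assoc]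

variable {W}

theorem IsLeftCounital.εL_mul {a : A} (ha : W.IsLeftCounital a) (x : A) :
    W.εL (a * x) = a * W.εL x := by
  rw [εL_eq_conv, conv_apply, conv_apply, ha.Δ_mul]
  generalize W.Δ x = u
  induction u with
  | zero => simp
  | add u₁ u₂ h₁ h₂ => simp only [map_add, mul_add, h₁, h₂]
  | tmul c d => simp [mul_assoc]

end WeakHopfData

namespace HaarPkg

variable {A : Type*} [NormedRing A] [StarRing A] [CStarRing A]
  [NormedAlgebra ℂ A] [StarModule ℂ A] [FiniteDimensional ℂ A] (P : HaarPkg A)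

theorem isLeftCounital_inverse_gL_mul_self :
    P.W.IsLeftCounital (Ring.inverse P.gL * Ring.inverse P.gL) := by
  obtain ⟨x, hx⟩ := P.gL_mem
  have h₁ : P.W.IsLeftCounital P.gL := hx ▸ P.W.isLeftCounital_εL x
  have h₂ := h₁.of_mul_eq_one (Ring.mul_inverse_cancel _ P.gL_unit)
    (Ring.inverse_mul_cancel _ P.gL_unit)
  exact h₂.mul h₂

theorem S_inverse_gL : P.W.S (Ring.inverse P.gL) = Ring.inverse P.gR := by
  rw [P.W.S_inverse P.gL_unit, P.gR_S]

theorem S_iotaEl_eq_εR :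
    P.W.S P.iotaEl = P.W.εR (Ring.inverse P.gR * Ring.inverse P.gR * P.h) := by
  rw [iotaEl, P.W.S_εL, P.W.S_antimul, P.W.S_antimul, P.S_inverse_gL, P.haar_S]

theorem g_mul_inverse_gL_sq :
    P.gL * Ring.inverse P.gR * (Ring.inverse P.gL * Ring.inverse P.gL) =
      Ring.inverse (P.gL * Ring.inverse P.gR) * (Ring.inverse P.gR * Ring.inverse P.gR) := by
  obtain ⟨u, hu⟩ := P.gL_unit
  obtain ⟨v, hv⟩ := P.gR_unit
  have huv : Commute u v := Units.ext (by simpa [hu, hv] using P.gLR_comm)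
  have key : u * v⁻¹ * (u⁻¹ * u⁻¹) = (u * v⁻¹)⁻¹ * (v⁻¹ * v⁻¹) := by
    have h₁ : v⁻¹ * u⁻¹ = u⁻¹ * v⁻¹ := huv.symm.inv_inv.eq
    calc u * v⁻¹ * (u⁻¹ * u⁻¹) = u * (v⁻¹ * u⁻¹) * u⁻¹ := by group
      _ = v * (v⁻¹ * u⁻¹) * v⁻¹ := by
        rw [h₁, mul_inv_cancel_left, h₁, ← h₁, mul_inv_cancel_left, h₁]
      _ = (u * v⁻¹)⁻¹ * (v⁻¹ * v⁻¹) := by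
        rw [h₁]
        group
  rw [← hu, ← hv, Ring.inverse_unit, Ring.inverse_unit, ← Units.val_mul, Ring.inverse_unit]
  exact_mod_cast congrArg Units.val key

theorem S_iotaEl : P.W.S P.iotaEl = P.iotaEl := by
  have hflip := congrArg (TensorProduct.comm ℂ A A) P.haar_flip
  rw [TensorProduct.comm_comm] at hflip
  have key : ∀ t : A ⊗[ℂ] A, P.W.S (LinearMap.mul' ℂ A
      (TensorProduct.map LinearMap.id P.W.S.toLinearMap
        (t * ((Ring.inverse P.gL * Ring.inverse P.gL) ⊗ₜ[ℂ] (1 : A))))) =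
      LinearMap.mul' ℂ A (TensorProduct.map LinearMap.id P.W.S.toLinearMap
        (TensorProduct.comm ℂ A A (TensorProduct.map LinearMap.id
          (LinearMap.mulLeft ℂ (P.gL * Ring.inverse P.gR) ∘ₗ
            LinearMap.mulRight ℂ (P.gL * Ring.inverse P.gR)) t) *
          ((Ring.inverse P.gL * Ring.inverse P.gL) ⊗ₜ[ℂ] (1 : A)))) := by
    intro t
    induction t with
    | zero => simp
    | add x y hx hy => simp only [map_add, add_mul, hx, hy]
    | tmul x y =>
      simp only [Algebra.TensorProduct.tmul_mul_tmul, TensorProduct.map_tmul, mul_one,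
        LinearMap.mul'_apply, LinearMap.id_apply, LinearEquiv.coe_coe, TensorProduct.comm_tmul,
        LinearMap.comp_apply, LinearMap.mulLeft_apply, LinearMap.mulRight_apply, P.W.S_antimul,
        P.S_sq, P.S_inverse_gL]
      have h₁ := congrArg (fun z => P.gL * Ring.inverse P.gR * (y * z) * P.W.S x)
        P.g_mul_inverse_gL_sq.symm
      simpa only [mul_assoc] using h₁
  rw [iotaEl, WeakHopfData.εL_eq_conv, WeakHopfData.conv_apply,
    P.isLeftCounital_inverse_gL_mul_self.Δ_mul', key, hflip]

theorem iotaEl_mem_center : P.iotaEl ∈ Set.center A := by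
  refine P.W.mem_center_of_adjoint (fun x => ?_) (fun x => ?_) fun x => ?_
  · have h₁ : P.W.IsRightCounital P.iotaEl := by
      rw [← P.S_iotaEl, P.S_iotaEl_eq_εR]
      exact P.W.isRightCounital_εR _
    exact ((P.W.isLeftCounital_εL x).commute h₁).symm
  · exact (P.W.isLeftCounital_εL _).commute (P.W.isRightCounital_εR x)
  · rw [iotaEl, P.W.conv_mulRight_εL, ← mul_assoc, P.haar_left, mul_assoc,
      (P.W.isLeftCounital_εL x).εL_mul]

theorem isPosElem_and_isUnit_iotaEl : IsPosElem P.iotaEl ∧ IsUnit P.iotaEl := by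
  have hcomplete : CompleteSpace A := FiniteDimensional.complete ℂ A
  let _ : CStarAlgebra A := { }
  let _ : PartialOrder A := CStarAlgebra.spectralOrder A
  have _ : StarOrderedRing A := CStarAlgebra.spectralOrderedRing A
  have hE : ∀ y : A, 0 ≤ (rapp P.hHat ∘ₗ P.W.Δ) (star y * y) := fun y => by
    rw [LinearMap.comp_apply, P.W.Δ_mul, P.W.Δ_star]
    exact rapp_star_mul_self_nonneg P.hHat_pos P.W.starT_add P.W.starT_tmul _
  have hgL : IsSelfAdjoint P.gL := by
    obtain ⟨y, hy⟩ := P.gL_pos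
    rw [hy]
    exact IsSelfAdjoint.star_mul_self y
  obtain ⟨h₁, h₂⟩ := nonneg_and_isUnit_of_conditional hE hgL P.gL_unit P.haar_star P.haar_idem
    P.iotaEl_mem_center P.gL_sq.symm
    (by
      rw [LinearMap.comp_apply, iotaEl, (P.W.isLeftCounital_εL _).Δ_mul, rapp_tmul_one_mul,
        P.gL_sq])
    (P.haar_left _)
  exact ⟨CStarAlgebra.nonneg_iff_eq_star_mul_self.mp h₁, h₂⟩

end HaarPkg

/-- **The Watatani index of the Haar conditional expectations.**
`ε^L (h gL⁻²) = ε^R (gR⁻² h)`, and this element `ı` is invertible, positive,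
invariant under the antipode, and hypercentral (`ı ∈ A^L ∩ A^R ∩ Z(A)`). -/
theorem HaarPkg.iota_hypercentral {A : Type*} [NormedRing A] [StarRing A] [CStarRing A]
    [NormedAlgebra ℂ A] [StarModule ℂ A] [FiniteDimensional ℂ A]
    (P : HaarPkg A) :
    WeakHopfData.εL P.W (P.h * (Ring.inverse P.gL * Ring.inverse P.gL))
      = WeakHopfData.εR P.W ((Ring.inverse P.gR * Ring.inverse P.gR) * P.h) ∧
    IsUnit P.iotaEl ∧ IsPosElem P.iotaEl ∧ P.W.S P.iotaEl = P.iotaEl ∧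
    P.iotaEl ∈ Set.range (WeakHopfData.εL P.W) ∧
    P.iotaEl ∈ Set.range (WeakHopfData.εR P.W) ∧
    P.iotaEl ∈ Set.center A := by
  refine ⟨?_, P.isPosElem_and_isUnit_iotaEl.2, P.isPosElem_and_isUnit_iotaEl.1, P.S_iotaEl,
    ⟨_, rfl⟩, ⟨_, P.S_iotaEl_eq_εR.symm.trans P.S_iotaEl⟩, P.iotaEl_mem_center⟩
  exact P.S_iotaEl.symm.trans P.S_iotaEl_eq_εR

end
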